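/- Let λ > −3 and p > 1 be such that −λq < 3, where 1/p + 1/q = 1, and set C_p(λ) := 2^{−λ} max(1, (4π/(3+λq))^{1/q}). Then for all measurable g, φ : ℝ³ → ℝ for which the norms on the right-hand side are finite: (i) if λ < 0, |∫_{ℝ³} (|·|^λ ∗ g)(v) φ(v) dv| ≤ C_p(λ) ‖⟨·⟩^{−λ} g‖_{L¹} ( ‖⟨·⟩^{λ} φ‖_{L¹} + ‖⟨·⟩^{λ} φ‖_{L^p} ); (ii) if λ ≥ 0, |∫_{ℝ³} (|·|^λ ∗ g)(v) φ(v) dv| ≤ ‖⟨·⟩^{λ} g‖_{L¹} ‖⟨·⟩^{λ} φ‖_{L¹}. (Proposition 2.5 of the paper.) -/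

import Mathlib

open MeasureTheory Real

noncomputable def jap (v : EuclideanSpace ℝ (Fin 3)) : ℝ := Real.sqrt (1 + ‖v‖ ^ 2)

abbrev E3 := EuclideanSpace ℝ (Fin 3)

lemma jap_ge (v : E3) : 1 ≤ jap v := by
  unfold jap
  rw [Real.one_le_sqrt]
  nlinarith [sq_nonneg ‖v‖]

lemma jap_pos (v : E3) : 0 < jap v := lt_of_lt_of_le one_pos (jap_ge v)

lemma jap_sq (v : E3) : jap v ^ 2 = 1 + ‖v‖ ^ 2 := by
  unfold jap
  rw [Real.sq_sqrt (by positivity)]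

lemma jap_meas : Measurable jap := by
  unfold jap
  fun_prop

lemma norm_sub_le_jap (v w : E3) : ‖v - w‖ ≤ jap v * jap w := by
  have h := norm_sub_le v w
  have h1 := jap_sq v
  have h2 := jap_sq w
  have : ‖v‖ + ‖w‖ ≤ jap v * jap w := by
    apply le_of_sq_le_sq _ (by have := jap_pos v; have := jap_pos w; positivity)
    rw [mul_pow, h1, h2]
    nlinarith [sq_nonneg (‖v‖ * ‖w‖ - 1)]
  linarith

lemma peetre (v w : E3) : jap v ^ 2 ≤ 2 * (1 + ‖v - w‖ ^ 2) * jap w ^ 2 := by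
  have h : ‖v‖ ≤ ‖v - w‖ + ‖w‖ := by
    have := norm_add_le (v - w) w
    simpa using this
  rw [jap_sq, jap_sq]
  have h0 := norm_nonneg v
  have : ‖v‖ ^ 2 ≤ (‖v - w‖ + ‖w‖) ^ 2 := by gcongr
  nlinarith [sq_nonneg (‖v - w‖ - ‖w‖), mul_nonneg (sq_nonneg ‖v - w‖) (sq_nonneg ‖w‖)]

noncomputable def hk (s : ℝ) (y : ℝ) : ℝ := (Set.Iio (1 : ℝ)).indicator (fun y => y ^ s) y

lemma hk_meas (s : ℝ) : Measurable (hk s) := by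
  unfold hk
  exact Measurable.indicator (by fun_prop) measurableSet_Iio

lemma hk_nonneg (s : ℝ) {y : ℝ} (hy : 0 ≤ y) : 0 ≤ hk s y := by
  unfold hk
  exact Set.indicator_apply_nonneg fun _ => Real.rpow_nonneg hy _

lemma pointwise (lam : ℝ) (hl : lam < 0) (v w : E3) :
    ‖v - w‖ ^ lam ≤ 2 ^ (-lam) * jap w ^ (-lam) * (jap v ^ lam * (1 + hk lam ‖v - w‖)) := by
  have hv := jap_pos v
  have hw := jap_pos w
  have hP := peetre v w
  have key : ∀ t : ℝ, 0 < t → jap v ≤ 2 * t * jap w →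
      t ^ lam ≤ 2 ^ (-lam) * jap w ^ (-lam) * jap v ^ lam := by
    intro t ht h
    have h1 : (2 * t * jap w) ^ lam ≤ jap v ^ lam :=
      Real.rpow_le_rpow_of_nonpos hv h hl.le
    rw [Real.mul_rpow (by positivity) hw.le, Real.mul_rpow (by positivity) ht.le] at h1
    have e1 : (2:ℝ) ^ (-lam) * 2 ^ lam = 1 := by
      rw [← Real.rpow_add (by norm_num)]; simp
    have e2 : jap w ^ (-lam) * jap w ^ lam = 1 := by
      rw [← Real.rpow_add hw]; simp
    calc t ^ lam = ((2:ℝ) ^ (-lam) * 2 ^ lam) * (jap w ^ (-lam) * jap w ^ lam) * t ^ lam := by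
          rw [e1, e2]; ring
      _ = 2 ^ (-lam) * jap w ^ (-lam) * (2 ^ lam * t ^ lam * jap w ^ lam) := by ring
      _ ≤ _ := by gcongr
  by_cases hlt : ‖v - w‖ < 1
  · have k := key 1 one_pos (by
      apply le_of_sq_le_sq _ (by positivity)
      have : 1 + ‖v - w‖ ^ 2 ≤ 2 := by nlinarith [norm_nonneg (v - w)]
      nlinarith [mul_le_mul_of_nonneg_right this (sq_nonneg (jap w))])
    rw [Real.one_rpow] at k
    have : hk lam ‖v - w‖ = ‖v - w‖ ^ lam := by simp [hk, hlt]
    rw [this]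
    have h0 : 0 ≤ ‖v - w‖ ^ lam := by positivity
    nlinarith [mul_le_mul_of_nonneg_right k h0]
  · have hge : 1 ≤ ‖v - w‖ := not_lt.mp hlt
    have k := key ‖v - w‖ (by linarith) (by
      apply le_of_sq_le_sq _ (by positivity)
      have : 1 + ‖v - w‖ ^ 2 ≤ 2 * ‖v - w‖ ^ 2 := by nlinarith
      nlinarith [mul_le_mul_of_nonneg_right this (sq_nonneg (jap w))])
    have : hk lam ‖v - w‖ = 0 := by simp [hk, hge]
    rw [this]
    linarith

lemma ball_int (s : ℝ) (hs : -3 < s) :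
    ∫⁻ z : E3, ENNReal.ofReal (hk s ‖z‖) = ENNReal.ofReal (4 * π / (3 + s)) := by
  have hfun : ∀ y ∈ Set.Ioi (0:ℝ), y ^ (Module.finrank ℝ E3 - 1) • hk s y
      = (Set.Ioo (0:ℝ) 1).indicator (fun y => y ^ (s + 2)) y := by
    intro y hy
    have hy' : 0 < y := hy
    simp only [finrank_euclideanSpace_fin, hk, smul_eq_mul]
    by_cases h : y < 1
    · simp [h, hy', Real.rpow_add hy', mul_comm]
    · simp [h]
  have hint : IntegrableOn (fun y : ℝ => y ^ (s + 2)) (Set.Ioo 0 1) := by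
    exact (intervalIntegral.integrableOn_Ioo_rpow_iff one_pos).2 (by linarith)
  have hI : Integrable (fun z : E3 => hk s ‖z‖) := by
    rw [integrable_fun_norm_addHaar volume (f := hk s), integrableOn_congr_fun hfun measurableSet_Ioi]
    exact ((integrable_indicator_iff measurableSet_Ioo).2 hint).integrableOn
  rw [← ofReal_integral_eq_lintegral_ofReal hI
    (Filter.Eventually.of_forall fun z => hk_nonneg s (norm_nonneg z)),
    integral_fun_norm_addHaar volume (hk s), setIntegral_congr_fun measurableSet_Ioi hfun,
    setIntegral_indicator measurableSet_Ioo]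
  have : Set.Ioi (0:ℝ) ∩ Set.Ioo 0 1 = Set.Ioo 0 1 := by
    ext x; simp
  rw [this, ← integral_Ioc_eq_integral_Ioo, ← intervalIntegral.integral_of_le zero_le_one,
    integral_rpow (Or.inl (by linarith))]
  congr 1
  have hb : (volume : Measure E3).real (Metric.ball 0 1) = π * 4 / 3 := by
    rw [Measure.real, EuclideanSpace.volume_ball_fin_three]
    simp
    positivity
  rw [hb]
  have h3 : 3 + s ≠ 0 := by linarith
  have h4 : s + 2 + 1 ≠ 0 := by linarith
  rw [Real.zero_rpow h4, Real.one_rpow]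
  simp
  field_simp
  ring

lemma enorm_eq (x : ℝ) : ‖x‖ₑ = ENNReal.ofReal |x| := by
  rw [← ofReal_norm, Real.norm_eq_abs]

/-- reduction by Tonelli -/
lemma reduction (lam a K : ℝ) (hK : 0 ≤ K) (g φ : E3 → ℝ) (hg : Measurable g) (hφ : Measurable φ)
    (hgi : Integrable (fun v => |g v| * jap v ^ a))
    (H : ∀ w, ∫⁻ v, ENNReal.ofReal (‖v - w‖ ^ lam) * ENNReal.ofReal |φ v| ≤
      ENNReal.ofReal (jap w ^ a) * ENNReal.ofReal K) :
    |∫ v, (∫ w, ‖v - w‖ ^ lam * g w) * φ v| ≤ K * ∫ v, |g v| * jap v ^ a := by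
  have hn : ∀ v, 0 ≤ |g v| * jap v ^ a := fun v =>
    mul_nonneg (abs_nonneg _) (Real.rpow_nonneg (jap_pos v).le _)
  rw [← ENNReal.ofReal_le_ofReal_iff (mul_nonneg hK (integral_nonneg hn)), ← enorm_eq]
  calc ‖∫ v, (∫ w, ‖v - w‖ ^ lam * g w) * φ v‖ₑ
      ≤ ∫⁻ v, ‖(∫ w, ‖v - w‖ ^ lam * g w) * φ v‖ₑ := enorm_integral_le_lintegral_enorm _
    _ ≤ ∫⁻ v, ∫⁻ w, ENNReal.ofReal |g w| *
          (ENNReal.ofReal (‖v - w‖ ^ lam) * ENNReal.ofReal |φ v|) := by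
        refine lintegral_mono fun v => ?_
        rw [enorm_mul]
        calc _ ≤ (∫⁻ w, ‖‖v - w‖ ^ lam * g w‖ₑ) * ‖φ v‖ₑ := by
              gcongr
              exact enorm_integral_le_lintegral_enorm _
          _ = ∫⁻ w, ‖‖v - w‖ ^ lam * g w‖ₑ * ‖φ v‖ₑ := by
              rw [lintegral_mul_const' _ _ enorm_ne_top]
          _ ≤ _ := by
              refine lintegral_mono fun w => le_of_eq ?_
              rw [enorm_mul, enorm_eq, enorm_eq, enorm_eq, abs_of_nonneg (by positivity)]
              ring
    _ = ∫⁻ w, ∫⁻ v, ENNReal.ofReal |g w| *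
          (ENNReal.ofReal (‖v - w‖ ^ lam) * ENNReal.ofReal |φ v|) := by
        apply lintegral_lintegral_swap
        apply Measurable.aemeasurable
        unfold Function.uncurry
        fun_prop
    _ ≤ ∫⁻ w, ENNReal.ofReal (|g w| * jap w ^ a) * ENNReal.ofReal K := by
        refine lintegral_mono fun w => ?_
        rw [lintegral_const_mul' _ _ ENNReal.ofReal_ne_top, ENNReal.ofReal_mul (abs_nonneg _),
          mul_assoc]
        gcongr
        exact H w
    _ = _ := by
        rw [lintegral_mul_const' _ _ ENNReal.ofReal_ne_top,
          ← ofReal_integral_eq_lintegral_ofReal hgi (Filter.Eventually.of_forall hn),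
          ENNReal.ofReal_mul hK, mul_comm]

lemma case_neg (lam p q : ℝ) (hp : 1 < p)
    (hpq : 1 / p + 1 / q = 1) (hlq : -lam * q < 3) (hl : lam < 0) (φ : E3 → ℝ) (hφ : Measurable φ)
    (h1 : Integrable (fun v => |φ v| * jap v ^ lam))
    (h2 : Integrable (fun v => |φ v| ^ p * jap v ^ (lam * p))) (w : E3) :
    ∫⁻ v, ENNReal.ofReal (‖v - w‖ ^ lam) * ENNReal.ofReal |φ v| ≤
      ENNReal.ofReal (jap w ^ (-lam)) * ENNReal.ofReal
      ((2 : ℝ) ^ (-lam) * max 1 ((4 * π / (3 + lam * q)) ^ (1 / q)) *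
            ((∫ v, |φ v| * jap v ^ lam) +
              (∫ v, |φ v| ^ p * jap v ^ (lam * p)) ^ (1 / p))) := by
  have hp0 : 0 < p := by linarith
  have hconj : q.HolderConjugate p := by
    apply Real.HolderConjugate.symm
    rw [Real.holderConjugate_iff]
    exact ⟨hp, by simpa [one_div] using hpq⟩
  have hq0 : 0 < q := hconj.pos
  have hm := jap_meas
  have hkm := hk_meas lam
  have hn1 : ∀ v, 0 ≤ |φ v| * jap v ^ lam := fun v =>
    mul_nonneg (abs_nonneg _) (Real.rpow_nonneg (jap_pos v).le _)
  have hn2 : ∀ v, 0 ≤ |φ v| ^ p * jap v ^ (lam * p) := fun v =>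
    mul_nonneg (by positivity) (Real.rpow_nonneg (jap_pos v).le _)
  set A := ∫ v, |φ v| * jap v ^ lam with hA
  set B := ∫ v, |φ v| ^ p * jap v ^ (lam * p) with hB
  have hA0 : 0 ≤ A := integral_nonneg hn1
  have hB0 : 0 ≤ B := integral_nonneg hn2
  have hc : 0 < 3 + lam * q := by linarith
  set c := 4 * π / (3 + lam * q) with hcdef
  have hc0 : 0 ≤ c := by positivity
  have holder : ∫⁻ v, ENNReal.ofReal (hk lam ‖v - w‖) * ENNReal.ofReal (|φ v| * jap v ^ lam) ≤
      ENNReal.ofReal (c ^ (1 / q) * B ^ (1 / p)) := by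
    refine (ENNReal.lintegral_mul_le_Lp_mul_Lq volume hconj
      (f := fun v => ENNReal.ofReal (hk lam ‖v - w‖))
      (g := fun v => ENNReal.ofReal (|φ v| * jap v ^ lam))
      (by fun_prop) (by fun_prop)).trans (le_of_eq ?_)
    have e1 : ∫⁻ v, ENNReal.ofReal (hk lam ‖v - w‖) ^ q = ENNReal.ofReal c := by
      rw [← ball_int (lam * q) (by linarith),
        ← lintegral_sub_right_eq_self (fun z : E3 => ENNReal.ofReal (hk (lam * q) ‖z‖)) w]
      refine lintegral_congr fun v => ?_
      rw [ENNReal.ofReal_rpow_of_nonneg (hk_nonneg _ (norm_nonneg _)) hq0.le]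
      congr 1
      unfold hk
      by_cases h : ‖v - w‖ < 1
      · simp [h, Real.rpow_mul]
      · simp [h, Real.zero_rpow hq0.ne']
    have e2 : ∫⁻ v, ENNReal.ofReal (|φ v| * jap v ^ lam) ^ p = ENNReal.ofReal B := by
      rw [hB, ofReal_integral_eq_lintegral_ofReal h2 (Filter.Eventually.of_forall hn2)]
      refine lintegral_congr fun v => ?_
      rw [ENNReal.ofReal_rpow_of_nonneg (hn1 v) hp0.le,
        Real.mul_rpow (abs_nonneg _) (Real.rpow_nonneg (jap_pos v).le _),
        Real.rpow_mul (jap_pos v).le]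
    rw [e1, e2, ENNReal.ofReal_rpow_of_nonneg hc0 (by positivity),
      ENNReal.ofReal_rpow_of_nonneg hB0 (by positivity), ← ENNReal.ofReal_mul (by positivity)]
  have hA' : ∫⁻ v, ENNReal.ofReal (|φ v| * jap v ^ lam) = ENNReal.ofReal A :=
    (ofReal_integral_eq_lintegral_ofReal h1 (Filter.Eventually.of_forall hn1)).symm
  have hjw : 0 ≤ jap w ^ (-lam) := Real.rpow_nonneg (jap_pos w).le _
  clear_value A B c
  calc _ ≤ ∫⁻ v, ENNReal.ofReal (2 ^ (-lam) * jap w ^ (-lam)) *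
        (ENNReal.ofReal (|φ v| * jap v ^ lam) +
          ENNReal.ofReal (hk lam ‖v - w‖) * ENNReal.ofReal (|φ v| * jap v ^ lam)) := by
        refine lintegral_mono fun v => ?_
        have hh := hk_nonneg lam (norm_nonneg (v - w))
        rw [← ENNReal.ofReal_mul (by positivity), ← ENNReal.ofReal_mul hh,
          ← ENNReal.ofReal_add (hn1 v) (mul_nonneg hh (hn1 v)),
          ← ENNReal.ofReal_mul (by positivity)]
        apply ENNReal.ofReal_le_ofReal
        have := mul_le_mul_of_nonneg_right (pointwise lam hl v w) (abs_nonneg (φ v))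
        linarith
    _ = ENNReal.ofReal (2 ^ (-lam) * jap w ^ (-lam)) * (ENNReal.ofReal A +
        ∫⁻ v, ENNReal.ofReal (hk lam ‖v - w‖) * ENNReal.ofReal (|φ v| * jap v ^ lam)) := by
        rw [lintegral_const_mul' _ _ ENNReal.ofReal_ne_top, lintegral_add_left (by fun_prop), hA']
    _ ≤ ENNReal.ofReal (2 ^ (-lam) * jap w ^ (-lam)) * (ENNReal.ofReal A +
        ENNReal.ofReal (c ^ (1 / q) * B ^ (1 / p))) := by gcongr
    _ ≤ _ := by
        have hB1 : 0 ≤ B ^ (1 / p) := by positivity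
        have hc1 : 0 ≤ c ^ (1 / q) := by positivity
        rw [← ENNReal.ofReal_add hA0 (by positivity), ← ENNReal.ofReal_mul (by positivity),
          ← ENNReal.ofReal_mul hjw]
        apply ENNReal.ofReal_le_ofReal
        have : A + c ^ (1 / q) * B ^ (1 / p) ≤ max 1 (c ^ (1 / q)) * (A + B ^ (1 / p)) := by
          have m1 := mul_le_mul_of_nonneg_right (le_max_left 1 (c ^ (1 / q))) hA0
          have m2 := mul_le_mul_of_nonneg_right (le_max_right 1 (c ^ (1 / q))) hB1
          linarith
        calc _ ≤ 2 ^ (-lam) * jap w ^ (-lam) * (max 1 (c ^ (1 / q)) * (A + B ^ (1 / p))) := by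
              gcongr
          _ = _ := by ring

lemma case_pos (lam : ℝ) (hl : 0 ≤ lam) (φ : E3 → ℝ)
    (h1 : Integrable (fun v => |φ v| * jap v ^ lam)) (w : E3) :
    ∫⁻ v, ENNReal.ofReal (‖v - w‖ ^ lam) * ENNReal.ofReal |φ v| ≤
      ENNReal.ofReal (jap w ^ lam) * ENNReal.ofReal (∫ v, |φ v| * jap v ^ lam) := by
  have hn1 : ∀ v, 0 ≤ |φ v| * jap v ^ lam := fun v =>
    mul_nonneg (abs_nonneg _) (Real.rpow_nonneg (jap_pos v).le _)
  have hjw : 0 ≤ jap w ^ lam := Real.rpow_nonneg (jap_pos w).le _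
  rw [ofReal_integral_eq_lintegral_ofReal h1 (Filter.Eventually.of_forall hn1),
    ← lintegral_const_mul' _ _ ENNReal.ofReal_ne_top]
  refine lintegral_mono fun v => ?_
  rw [← ENNReal.ofReal_mul (by positivity), ← ENNReal.ofReal_mul hjw]
  apply ENNReal.ofReal_le_ofReal
  have h := Real.rpow_le_rpow (norm_nonneg _) (norm_sub_le_jap v w) hl
  rw [Real.mul_rpow (jap_pos v).le (jap_pos w).le] at h
  have := mul_le_mul_of_nonneg_right h (abs_nonneg (φ v))
  linarith

/-- Proposition 2.5: convolution estimates for the kernel `|·|^λ`. -/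
theorem convolution_estimate (lam p q : ℝ) (hlam : -3 < lam) (hp : 1 < p)
    (hpq : 1 / p + 1 / q = 1) (hlq : -lam * q < 3) :
    ((lam < 0 → ∀ g φ : EuclideanSpace ℝ (Fin 3) → ℝ, Measurable g → Measurable φ →
      Integrable (fun v => |g v| * jap v ^ (-lam)) →
      Integrable (fun v => |φ v| * jap v ^ lam) →
      Integrable (fun v => |φ v| ^ p * jap v ^ (lam * p)) →
      |∫ v, (∫ w, ‖v - w‖ ^ lam * g w) * φ v| ≤
        (2 : ℝ) ^ (-lam) * max 1 ((4 * π / (3 + lam * q)) ^ (1 / q)) *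
          ((∫ v, |g v| * jap v ^ (-lam)) *
            ((∫ v, |φ v| * jap v ^ lam) +
              (∫ v, |φ v| ^ p * jap v ^ (lam * p)) ^ (1 / p)))) ∧
    (0 ≤ lam → ∀ g φ : EuclideanSpace ℝ (Fin 3) → ℝ, Measurable g → Measurable φ →
      Integrable (fun v => |g v| * jap v ^ lam) →
      Integrable (fun v => |φ v| * jap v ^ lam) →
      |∫ v, (∫ w, ‖v - w‖ ^ lam * g w) * φ v| ≤
        (∫ v, |g v| * jap v ^ lam) * (∫ v, |φ v| * jap v ^ lam))) := by
  refine ⟨fun hl g φ hg hφ h0 h1 h2 => ?_, fun hl g φ hg hφ h0 h1 => ?_⟩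
  · have hc : 0 ≤ ∫ v, |φ v| * jap v ^ lam := integral_nonneg fun v =>
      mul_nonneg (abs_nonneg _) (Real.rpow_nonneg (jap_pos v).le _)
    have hd : 0 ≤ ∫ v, |φ v| ^ p * jap v ^ (lam * p) := integral_nonneg fun v =>
      mul_nonneg (by positivity) (Real.rpow_nonneg (jap_pos v).le _)
    have := reduction lam (-lam) _ (by positivity) g φ hg hφ h0
      (case_neg lam p q hp hpq hlq hl φ hφ h1 h2)
    refine this.trans (le_of_eq ?_)
    ring
  · have hc : 0 ≤ ∫ v, |φ v| * jap v ^ lam := integral_nonneg fun v =>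
      mul_nonneg (abs_nonneg _) (Real.rpow_nonneg (jap_pos v).le _)
    rw [mul_comm (∫ v, |g v| * jap v ^ lam)]
    exact reduction lam lam _ hc g φ hg hφ h0 (case_pos lam hl φ h1)
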